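/- Let M and N be positive integers and let k be a natural number with max(M,N) ≥ τ^k. Then any prime squaring of the rectangle R = [0,M] × [0,N] ⊆ ℝ² (a dissection of R into n axis-parallel squares with positive integer side lengths a_1, …, a_n satisfying gcd(a_1, …, a_n) = 1) consists of at least k tiles, i.e., n ≥ k. -/

import Mathlib

/-- The closed axis-parallel square `[x, x+a] × [y, y+a] ⊆ ℝ²` with lower-left
corner `(x, y)` and side length `a`. -/
def sqTile (x y : ℝ) (a : ℕ) : Set (ℝ × ℝ) :=
  Set.Icc x (x + a) ×ˢ Set.Icc y (y + a)

/-- An integer matrix whose rows are split into two classes such that, within each class, every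
sum of distinct rows has entries in `{-1, 0, 1}`; equivalently every column has, within each
class, at most one entry `1`, at most one entry `-1`, and all other entries `0`. -/
def IsDoubleIncidence {ι κ : Type*} (cl : ι → Bool) (C : Matrix ι κ ℤ) : Prop :=
  ∀ (S : Finset ι) (b : Bool), (∀ i ∈ S, cl i = b) → ∀ j, |∑ i ∈ S, C i j| ≤ 1

namespace IsDoubleIncidence

variable {ι κ : Type*} {cl : ι → Bool} {C : Matrix ι κ ℤ}

theorem abs_apply_le (h : IsDoubleIncidence cl C) (i : ι) (j : κ) : |C i j| ≤ 1 := by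
  simpa using h {i} (cl i) (by simp) j

/-- Zeroing out, in the column `e`, all rows outside one class. -/
theorem updateCol_class [DecidableEq κ] (h : IsDoubleIncidence cl C) (e : κ) (b : Bool) :
    IsDoubleIncidence cl (C.updateCol e fun i => if cl i = b then C i e else 0) := by
  intro S b' hS j
  by_cases hj : j = e
  · subst hj
    simp only [Matrix.updateCol_self]
    by_cases hb : b' = b
    · rw [Finset.sum_congr rfl fun i hi => if_pos ((hS i hi).trans hb)]
      exact h S b' hS j
    · rw [Finset.sum_congr rfl fun i hi => if_neg (by rw [hS i hi]; exact hb)]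
      simp
  · simp only [Matrix.updateCol_ne hj]
    exact h S b' hS j

/-- Pivoting on an entry of a column that vanishes outside one class yields a smaller matrix of the
same kind, with the same determinant up to sign; rows of the other class are left alone. -/
theorem exists_pivot {n : ℕ} {cl : Fin (n + 1) → Bool} {C : Matrix (Fin (n + 1)) (Fin (n + 1)) ℤ}
    (h : IsDoubleIncidence cl C) (e p : Fin (n + 1)) (hp : C p e ≠ 0)
    (he : ∀ i, cl i ≠ cl p → C i e = 0) :
    ∃ C' : Matrix (Fin n) (Fin n) ℤ, IsDoubleIncidence (cl ∘ p.succAbove) C' ∧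
      |C.det| = |C'.det| ∧
      ∀ i, cl (p.succAbove i) ≠ cl p → ∀ j, C' i j = C (p.succAbove i) (e.succAbove j) := by
  have hpp : C p e * C p e = 1 := by
    have := h.abs_apply_le p e
    rw [abs_le] at this
    have : C p e = 1 ∨ C p e = -1 := by omega
    rcases this with h | h <;> simp [h]
  let D : Matrix (Fin (n + 1)) (Fin (n + 1)) ℤ := Matrix.of fun i j =>
    if i = p then C p j else C i j - C i e * C p e * C p j
  have hD : C.det = D.det := by
    symm
    refine Matrix.det_eq_of_forall_row_eq_smul_add_const
      (fun i => if i = p then 0 else - (C i e * C p e)) p (by simp) fun i j => ?_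
    by_cases hi : i = p
    · simp [D, hi]
    · simp [D, hi]; ring
  refine ⟨D.submatrix p.succAbove e.succAbove, ?_, ?_, ?_⟩
  · intro S b hS j
    have hrow : ∀ i, D.submatrix p.succAbove e.succAbove i j = C (p.succAbove i) (e.succAbove j)
        - C (p.succAbove i) e * C p e * C p (e.succAbove j) := fun i => by
      simp [D, Fin.succAbove_ne]
    simp only [hrow, Finset.sum_sub_distrib, ← Finset.sum_mul]
    have hmap : ∀ k, ∑ i ∈ S.map p.succAboveEmb, C i k = ∑ i ∈ S, C (p.succAbove i) k :=
      fun k => by simp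
    have hcl : ∀ i ∈ S.map p.succAboveEmb, cl i = b := by
      intro i hi
      obtain ⟨i', hi', rfl⟩ := Finset.mem_map.1 hi
      exact hS i' hi'
    have h1 := h _ b hcl
    by_cases hb : b = cl p
    · have hpS : p ∉ S.map p.succAboveEmb := by simp [Fin.succAbove_ne]
      have h2 := h (insert p (S.map p.succAboveEmb)) b (by
        intro i hi
        rcases Finset.mem_insert.1 hi with rfl | hi
        · exact hb.symm
        · exact hcl i hi)
      simp only [Finset.sum_insert hpS, hmap] at h1 h2
      have a1 := h1 e
      have a2 := h2 e
      have a3 := h1 (e.succAbove j)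
      have a4 := h2 (e.succAbove j)
      rw [abs_le] at *
      generalize ∑ i ∈ S, C (p.succAbove i) e = s at *
      have hp' : C p e = 1 ∨ C p e = -1 := by
        have := h.abs_apply_le p e
        rw [abs_le] at this
        omega
      have hs : s = 0 ∨ s = - C p e := by omega
      rcases hs with rfl | rfl
      · simpa using a3
      · rw [neg_mul, hpp]
        constructor <;> linarith
    · have h0 : ∑ i ∈ S, C (p.succAbove i) e = 0 :=
        Finset.sum_eq_zero fun i hi => he _ (by
          rw [show cl (p.succAbove i) = b from hS i hi]; exact hb)
      rw [h0]
      simpa [hmap] using h1 (e.succAbove j)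
  · rw [hD, Matrix.det_succ_column D e, Finset.sum_eq_single p]
    · have : |C p e| = 1 := by
        rcases mul_self_eq_one_iff.1 hpp with h | h <;> simp [h]
      simp [D, abs_mul, this]
    · intro i _ hi
      have : D i e = 0 := by
        simp only [D, Matrix.of_apply, if_neg hi]
        linear_combination - C i e * hpp
      simp [this]
    · simp
  · intro i hi j
    simp [D, Fin.succAbove_ne, he _ hi]

/-- The part of a determinant carried by one class of entries of the column `e`. -/
theorem abs_det_updateCol_le {n : ℕ} {cl : Fin (n + 1) → Bool}
    {C : Matrix (Fin (n + 1)) (Fin (n + 1)) ℤ} (h : IsDoubleIncidence cl C) (e : Fin (n + 1))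
    (b : Bool) {B : ℝ} (hB0 : 0 ≤ B)
    (hB : ∀ (p : Fin (n + 1)) (C' : Matrix (Fin n) (Fin n) ℤ), cl p = b →
      IsDoubleIncidence (cl ∘ p.succAbove) C' →
      (∀ i, cl (p.succAbove i) ≠ b → ∀ j, C' i j = C (p.succAbove i) (e.succAbove j)) →
      |(C'.det : ℝ)| ≤ B) :
    |((C.updateCol e fun i => if cl i = b then C i e else 0).det : ℝ)| ≤ B := by
  by_cases hz : ∃ p, cl p = b ∧ C p e ≠ 0
  · obtain ⟨p, hpb, hp⟩ := hz
    obtain ⟨C', h1, h2, h3⟩ := (h.updateCol_class e b).exists_pivot e p (by simp [hpb, hp])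
      (fun i hi => by rw [hpb] at hi; simp [hi])
    rw [← Int.cast_abs, h2, Int.cast_abs]
    refine hB p C' hpb h1 fun i hi j => ?_
    rw [h3 i (by rwa [hpb]) j, Matrix.updateCol_ne (Fin.succAbove_ne e j)]
  · push Not at hz
    rw [Matrix.det_eq_zero_of_column_eq_zero e]
    · simpa using hB0
    · intro i
      by_cases hi : cl i = b
      · simp [hi, hz i hi]
      · simp [hi]

/-- Expansion of the determinant along a row with at most `k` nonzero entries. -/
theorem abs_det_le_of_sum_abs_le {τ : ℝ} (hτ : 0 < τ) {m : ℕ}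
    (ih : ∀ n < m, ∀ (cl : Fin n → Bool) (C : Matrix (Fin n) (Fin n) ℤ),
      IsDoubleIncidence cl C → |(C.det : ℝ)| ≤ τ ^ n) (k : ℕ) :
    ∀ n ≤ m, ∀ (cl : Fin n → Bool) (C : Matrix (Fin n) (Fin n) ℤ), IsDoubleIncidence cl C →
      ∀ v, ∑ j, |C v j| ≤ k → |(C.det : ℝ)| ≤ τ ^ n * ∑ i ∈ Finset.range k, τ⁻¹ ^ (i + 1) := by
  induction k with
  | zero =>
    intro n _ cl C h v hv
    have hz : ∀ j, C v j = 0 := by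
      have := (Finset.sum_eq_zero_iff_of_nonneg fun j _ => abs_nonneg (C v j)).1
        (le_antisymm (by simpa using hv) (Finset.sum_nonneg fun j _ => abs_nonneg (C v j)))
      simpa using this
    simp [Matrix.det_eq_zero_of_row_eq_zero v hz]
  | succ k ihk =>
    intro n hn cl C h v hv
    obtain _ | n := n
    · exact v.elim0
    by_cases hz : ∀ j, C v j = 0
    · rw [Matrix.det_eq_zero_of_row_eq_zero v hz]
      simp only [Int.cast_zero, abs_zero]
      positivity
    push Not at hz
    obtain ⟨e, he⟩ := hz
    have hsplit : C.det = (C.updateCol e fun i => if cl i = cl v then C i e else 0).det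
        + (C.updateCol e fun i => if cl i = !cl v then C i e else 0).det := by
      rw [← Matrix.det_updateCol_add]
      congr 1
      conv_lhs => rw [← Matrix.updateCol_eq_self C e]
      congr 1
      funext i
      by_cases hi : cl i = cl v <;> simp [hi, ← Bool.eq_not]
    have h1 := h.abs_det_updateCol_le e (cl v) (B := τ ^ n) (by positivity)
      fun p C' _ hC' _ => ih n (by omega) _ C' hC'
    have h2 := h.abs_det_updateCol_le e (!cl v)
      (B := τ ^ n * ∑ i ∈ Finset.range k, τ⁻¹ ^ (i + 1)) (by positivity) (by
        intro p C' hp hC' hrow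
        have hvp : v ≠ p := by rintro rfl; simp at hp
        obtain ⟨v', rfl⟩ := Fin.exists_succAbove_eq hvp
        refine ihk n (by omega) _ C' hC' v' ?_
        rw [Finset.sum_congr rfl fun j _ => by rw [hrow v' (by simp) j]]
        rw [Fin.sum_univ_succAbove _ e] at hv
        have := abs_pos.2 he
        push_cast at hv
        linarith)
    rw [hsplit, Int.cast_add]
    refine (abs_add_le _ _).trans ((add_le_add h1 h2).trans (le_of_eq ?_))
    have hsum : ∑ i ∈ Finset.range (k + 1), τ⁻¹ ^ (i + 1)
        = τ⁻¹ * (1 + ∑ i ∈ Finset.range k, τ⁻¹ ^ (i + 1)) := by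
      rw [Finset.sum_range_succ', mul_add, Finset.mul_sum, add_comm]
      simp [pow_succ']
    rw [hsum, pow_succ, mul_assoc, mul_inv_cancel_left₀ hτ.ne', mul_add, mul_one]

theorem sum_abs_class_le [Fintype ι] (h : IsDoubleIncidence cl C) (b : Bool) (j : κ) :
    ∑ i with cl i = b, |C i j| ≤ 2 - |∑ i with cl i = b, C i j| := by
  have key : ∀ s : ℤ, (s = 1 ∨ s = -1) → ∑ i with cl i = b, max 0 (s * C i j) ≤ 1 := by
    intro s hs
    have := h ({i | cl i = b ∧ 0 ≤ s * C i j} : Finset ι) b (by simp +contextual) j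
    rw [abs_le] at this
    have e : ∑ i with cl i = b, max 0 (s * C i j)
        = s * ∑ i with cl i = b ∧ 0 ≤ s * C i j, C i j := by
      rw [Finset.sum_filter, Finset.sum_filter, Finset.mul_sum]
      refine Finset.sum_congr rfl fun i _ => ?_
      by_cases hi : cl i = b
      · by_cases h0 : 0 ≤ s * C i j
        · simp [hi, h0]
        · simp [hi, h0, le_of_not_ge h0]
      · simp [hi]
    rw [e]
    rcases hs with rfl | rfl <;> omega
  have k1 := key 1 (by simp)
  have k2 := key (-1) (by simp)
  have e1 : ∑ i with cl i = b, |C i j| = ∑ i with cl i = b, max 0 (1 * C i j)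
      + ∑ i with cl i = b, max 0 (-1 * C i j) := by
    rw [← Finset.sum_add_distrib]
    refine Finset.sum_congr rfl fun i _ => ?_
    rcases abs_cases (C i j) with ⟨h, _⟩ | ⟨h, _⟩ <;> omega
  have e2 : ∑ i with cl i = b, C i j = ∑ i with cl i = b, max 0 (1 * C i j)
      - ∑ i with cl i = b, max 0 (-1 * C i j) := by
    rw [← Finset.sum_sub_distrib]
    refine Finset.sum_congr rfl fun i _ => ?_
    omega
  have p1 : 0 ≤ ∑ i with cl i = b, max 0 (1 * C i j) :=
    Finset.sum_nonneg fun i _ => le_max_left _ _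
  have p2 : 0 ≤ ∑ i with cl i = b, max 0 (-1 * C i j) :=
    Finset.sum_nonneg fun i _ => le_max_left _ _
  rcases abs_cases (∑ i with cl i = b, C i j) with ⟨h, _⟩ | ⟨h, _⟩ <;> omega

/-- A nonsingular square matrix has a row with at most three nonzero entries. -/
theorem exists_sum_abs_le_three {n : ℕ} {cl : Fin n → Bool} {C : Matrix (Fin n) (Fin n) ℤ}
    (h : IsDoubleIncidence cl C) (hn : 0 < n) (hdet : C.det ≠ 0) : ∃ v, ∑ j, |C v j| ≤ 3 := by
  by_contra! hc
  let b := cl ⟨0, hn⟩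
  have hsplit : ∀ j, ∑ i, |C i j| = ∑ i with cl i = b, |C i j| + ∑ i with cl i = !b, |C i j| := by
    intro j
    rw [← Finset.sum_filter_add_sum_filter_not _ (fun i => cl i = b)]
    simp [Bool.eq_not]
  have hcol : ∀ j, ∑ i, |C i j| ≤ 4 - |∑ i with cl i = b, C i j| := fun j => by
    have h1 := h.sum_abs_class_le b j
    have h2 := h.sum_abs_class_le (!b) j
    have h3 := abs_nonneg (∑ i with cl i = !b, C i j)
    rw [hsplit]
    omega
  have htot : ∑ j, ∑ i, |C i j| = ∑ i, ∑ j, |C i j| := Finset.sum_comm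
  have h1 : ∑ i : Fin n, (4 : ℤ) ≤ ∑ i, ∑ j, |C i j| := Finset.sum_le_sum fun i _ => hc i
  have h2 := Finset.sum_le_sum fun j (_ : j ∈ Finset.univ) => hcol j
  rw [Finset.sum_sub_distrib] at h2
  have h0 : ∑ j, |∑ i with cl i = b, C i j| = 0 :=
    le_antisymm (by omega) (Finset.sum_nonneg fun j _ => abs_nonneg _)
  rw [Finset.sum_eq_zero_iff_of_nonneg fun j _ => abs_nonneg _] at h0
  refine hdet (Matrix.exists_vecMul_eq_zero_iff.1 ⟨fun i => if cl i = b then 1 else 0, ?_, ?_⟩)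
  · intro hz
    simpa [b] using congrFun hz ⟨0, hn⟩
  · funext j
    have := h0 j (Finset.mem_univ j)
    rw [abs_eq_zero, Finset.sum_filter] at this
    simpa [Matrix.vecMul, dotProduct] using this

theorem abs_det_le {τ : ℝ} (hτ1 : 1 ≤ τ) (hτ : τ ^ 2 + τ + 1 ≤ τ ^ 3) (n : ℕ) :
    ∀ (cl : Fin n → Bool) (C : Matrix (Fin n) (Fin n) ℤ), IsDoubleIncidence cl C →
      |(C.det : ℝ)| ≤ τ ^ n := by
  have hτ0 : 0 < τ := by linarith
  induction n using Nat.strong_induction_on with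
  | _ n ih =>
    intro cl C h
    by_cases hdet : C.det = 0
    · simp only [hdet, Int.cast_zero, abs_zero]
      positivity
    rcases Nat.eq_zero_or_pos n with rfl | hn
    · simp
    obtain ⟨v, hv⟩ := h.exists_sum_abs_le_three hn hdet
    refine (abs_det_le_of_sum_abs_le hτ0 ih 3 n le_rfl cl C h v hv).trans
      (mul_le_of_le_one_right (by positivity) ?_)
    have : ∑ i ∈ Finset.range 3, τ⁻¹ ^ (i + 1) = (τ ^ 2 + τ + 1) / τ ^ 3 := by
      simp only [Finset.sum_range_succ, Finset.sum_range_zero, inv_pow]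
      field_simp
      ring
    rw [this]
    exact (div_le_one (by positivity)).2 hτ

end IsDoubleIncidence

/-- A matrix with trivial kernel has a nonsingular square submatrix formed from its rows. -/
theorem Matrix.exists_det_submatrix_ne_zero {K ι : Type*} [Field K] [Finite ι] {n : ℕ}
    (F : Matrix ι (Fin n) K) (hF : ∀ b, F.mulVec b = 0 → b = 0) :
    ∃ f : Fin n → ι, (F.submatrix f id).det ≠ 0 := by
  have hrank : F.rank = n := by
    have : Function.Injective F.mulVecLin :=
      (injective_iff_map_eq_zero _).2 fun b hb => hF b (by simpa using hb)
    rw [Matrix.rank, LinearMap.finrank_range_of_inj this]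
    simp
  obtain ⟨κ, f, -, hspan, hli⟩ := exists_linearIndependent' K F.row
  have : Finite κ := hli.finite
  have := Fintype.ofFinite κ
  have hcard : Fintype.card κ = n := by
    rw [← hrank, Matrix.rank_eq_finrank_span_row, ← hspan, finrank_span_eq_card hli]
  let e : Fin n ≃ κ := (Fintype.equivFinOfCardEq hcard).symm
  refine ⟨f ∘ e, ?_⟩
  have hu : IsUnit (F.submatrix (f ∘ e) id) :=
    Matrix.linearIndependent_rows_iff_isUnit.1 (hli.comp e e.injective)
  exact ((Matrix.isUnit_iff_isUnit_det _).1 hu).ne_zero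

/-- If pairwise disjoint intervals cover `[p, q)`, the lengths of their intersections with `[p, q)`
have total `q - p`. -/
theorem sum_length_inter_Ico {ι : Type*} {J : Finset ι} {l r : ι → ℝ} {p q : ℝ} (hpq : p ≤ q)
    (hdisj : ∀ i ∈ J, ∀ j ∈ J, l i < r j → l j < r i → i = j)
    (hcov : ∀ t ∈ Set.Ico p q, ∃ j ∈ J, t ∈ Set.Ico (l j) (r j)) :
    ∑ j ∈ J, max (min q (r j) - max p (l j)) 0 = q - p := by
  have hU : Set.Ico p q = ⋃ j ∈ J, Set.Ico (max p (l j)) (min q (r j)) := by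
    ext t
    simp only [Set.mem_iUnion, ← Set.Ico_inter_Ico, Set.mem_inter_iff, exists_prop]
    exact ⟨fun ht => (hcov t ht).imp fun j hj => ⟨hj.1, ht, hj.2⟩, fun ⟨_, _, ht, _⟩ => ht⟩
  have hvol := MeasureTheory.measureReal_biUnion_finset (μ := MeasureTheory.volume)
    (s := J) (f := fun j => Set.Ico (max p (l j)) (min q (r j)))
    (fun i hi j hj hij => Set.disjoint_left.2 fun t hti htj => hij <| hdisj i hi j hj
      (by
        have := (le_max_right _ _).trans hti.1
        have := htj.2.trans_le (min_le_right _ _)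
        linarith)
      (by
        have := (le_max_right _ _).trans htj.1
        have := hti.2.trans_le (min_le_right _ _)
        linarith))
    (fun _ _ => measurableSet_Ico)
    (fun _ _ => by simp)
  rw [← hU, Real.volume_real_Ico_of_le hpq] at hvol
  rw [hvol]
  exact Finset.sum_congr rfl fun j _ => Real.volume_real_Ico.symm

/-- The squares `[x i, x i + a i] × [y i, y i + a i]` tile the rectangle `[0, M] × [0, N]`. -/
structure IsSquareTiling (M N : ℝ) {n : ℕ} (x y a : Fin n → ℝ) : Prop where
  pos : ∀ i, 0 < a i
  left_nonneg : ∀ i, 0 ≤ x i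
  right_le : ∀ i, x i + a i ≤ M
  bot_nonneg : ∀ i, 0 ≤ y i
  top_le : ∀ i, y i + a i ≤ N
  eq_of_overlap : ∀ i j, x i < x j + a j → x j < x i + a i → y i < y j + a j → y j < y i + a i →
    i = j
  cover : ∀ s t, 0 ≤ s → s ≤ M → 0 ≤ t → t ≤ N →
    ∃ i, x i ≤ s ∧ s ≤ x i + a i ∧ y i ≤ t ∧ t ≤ y i + a i

/-- The top side `(i, true)` of one square and the bottom side `(j, false)` of another share a
nondegenerate segment. -/
def Touch {n : ℕ} (x y a : Fin n → ℝ) (s t : Fin n × Bool) : Prop :=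
  s.2 = true ∧ t.2 = false ∧ y s.1 + a s.1 = y t.1 ∧
    x s.1 < x t.1 + a t.1 ∧ x t.1 < x s.1 + a s.1

open Classical in
/-- The horizontal segment containing the bottom side of the square `j`, unless that side lies
on the boundary of the rectangle. -/
noncomputable def lowerSegment {n : ℕ} (x y a : Fin n → ℝ) (j : Fin n) :
    Option (Quot (Touch x y a)) :=
  if y j = 0 then none else some (Quot.mk _ (j, false))

open Classical in
/-- The horizontal segment containing the top side of the square `j`, unless that side lies
on the boundary of the rectangle. -/
noncomputable def upperSegment (N : ℝ) {n : ℕ} (x y a : Fin n → ℝ) (j : Fin n) :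
    Option (Quot (Touch x y a)) :=
  if y j + a j = N then none else some (Quot.mk _ (j, true))

open Classical in
/-- The incidence matrix of interior horizontal segments and squares. -/
noncomputable def segmentMatrix (N : ℝ) {n : ℕ} (x y a : Fin n → ℝ) :
    Matrix (Quot (Touch x y a)) (Fin n) ℤ :=
  Matrix.of fun c j => (if lowerSegment x y a j = some c then 1 else 0)
    - (if upperSegment N x y a j = some c then 1 else 0)

open Classical in
theorem sum_mul_side_eq_zero {N : ℝ} {n : ℕ} {x y a b : Fin n → ℝ}
    (hb : ∀ c, ∑ j, (segmentMatrix N x y a c j : ℝ) * b j = 0) (φ : Fin n × Bool → ℝ)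
    (hφ : ∀ s t, Touch x y a s t → φ s = φ t) :
    ∑ j, b j * ((if y j = 0 then 0 else φ (j, false))
      - (if y j + a j = N then 0 else φ (j, true))) = 0 := by
  have : Fintype (Quot (Touch x y a)) := Fintype.ofFinite _
  have h : ∀ j, b j * ((if y j = 0 then 0 else φ (j, false))
      - (if y j + a j = N then 0 else φ (j, true)))
      = ∑ c, Quot.lift φ hφ c * ((segmentMatrix N x y a c j : ℝ) * b j) := by
    intro j
    have h1 : ∑ c, Quot.lift φ hφ c * (if lowerSegment x y a j = some c then 1 else 0)
        = if y j = 0 then 0 else φ (j, false) := by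
      by_cases hj : y j = 0 <;> simp [lowerSegment, hj]
    have h2 : ∑ c, Quot.lift φ hφ c * (if upperSegment N x y a j = some c then 1 else 0)
        = if y j + a j = N then 0 else φ (j, true) := by
      by_cases hj : y j + a j = N <;> simp [upperSegment, hj]
    rw [← h1, ← h2, ← Finset.sum_sub_distrib, Finset.mul_sum]
    refine Finset.sum_congr rfl fun c _ => ?_
    simp only [segmentMatrix, Matrix.of_apply]
    push_cast
    ring
  simp only [h]
  rw [Finset.sum_comm]
  simp [← Finset.mul_sum, hb]

namespace IsSquareTiling

variable {M N : ℝ} {n : ℕ} {x y a : Fin n → ℝ}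

theorem swap (h : IsSquareTiling M N x y a) : IsSquareTiling N M y x a where
  pos := h.pos
  left_nonneg := h.bot_nonneg
  right_le := h.top_le
  bot_nonneg := h.left_nonneg
  top_le := h.right_le
  eq_of_overlap i j h1 h2 h3 h4 := h.eq_of_overlap i j h3 h4 h1 h2
  cover s t h1 h2 h3 h4 := by
    obtain ⟨i, h5, h6, h7, h8⟩ := h.cover t s h3 h4 h1 h2
    exact ⟨i, h7, h8, h5, h6⟩

theorem reflect (h : IsSquareTiling M N x y a) :
    IsSquareTiling M N x (fun i => N - y i - a i) a where
  pos := h.pos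
  left_nonneg := h.left_nonneg
  right_le := h.right_le
  bot_nonneg i := by linarith [h.top_le i]
  top_le i := by linarith [h.bot_nonneg i]
  eq_of_overlap i j h1 h2 h3 h4 := h.eq_of_overlap i j h1 h2 (by linarith) (by linarith)
  cover s t h1 h2 h3 h4 := by
    obtain ⟨i, h5, h6, h7, h8⟩ := h.cover s (N - t) h1 h2 (by linarith) (by linarith)
    exact ⟨i, h5, h6, by linarith, by linarith⟩

theorem exists_mem_Ico (h : IsSquareTiling M N x y a) {s t : ℝ} (hs : s ∈ Set.Ico 0 M)
    (ht : t ∈ Set.Ico 0 N) :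
    ∃ j, s ∈ Set.Ico (x j) (x j + a j) ∧ t ∈ Set.Ico (y j) (y j + a j) := by
  have key : ∀ (u : Fin n → ℝ) (s M : ℝ), s < M →
      ∃ s', s < s' ∧ s' ≤ M ∧ ∀ j, u j ≤ s' → u j ≤ s := by
    intro u s M hsM
    have h1 : ∀ᶠ s' in nhdsWithin s (Set.Ioi s), ∀ j, u j ≤ s' → u j ≤ s := by
      refine Filter.eventually_all.2 fun j => ?_
      by_cases hj : u j ≤ s
      · exact Filter.Eventually.of_forall fun _ _ => hj
      · filter_upwards [Ioo_mem_nhdsGT (not_le.1 hj)] with s' hs' h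
        exact absurd hs'.2 (not_lt.2 h)
    obtain ⟨s', h2, h3⟩ := (h1.and (Ioc_mem_nhdsGT hsM)).exists
    exact ⟨s', h3.1, h3.2, h2⟩
  obtain ⟨s', hs1, hs2, hs3⟩ := key x s M hs.2
  obtain ⟨t', ht1, ht2, ht3⟩ := key y t N ht.2
  obtain ⟨j, h1, h2, h3, h4⟩ := h.cover s' t' (hs.1.trans hs1.le) hs2 (ht.1.trans ht1.le) ht2
  exact ⟨j, ⟨hs3 j h1, hs1.trans_le h2⟩, ht3 j h3, ht1.trans_le h4⟩

/-- The squares resting on a horizontal segment in the interior of the rectangle cover it. -/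
theorem sum_overlap_eq (h : IsSquareTiling M N x y a) {p q t : ℝ} (hp : 0 ≤ p) (hpq : p ≤ q)
    (hq : q ≤ M) (ht : t ∈ Set.Ico 0 N)
    (hcut : ∀ j, p < x j + a j → x j < q → t < y j + a j → t ≤ y j) :
    ∑ j, (if t = y j then max (min q (x j + a j) - max p (x j)) 0 else 0) = q - p := by
  rw [← Finset.sum_filter]
  refine sum_length_inter_Ico hpq ?_ ?_
  · intro i hi j hj h1 h2
    have hi' : t = y i := by simpa using hi
    have hj' : t = y j := by simpa using hj
    exact h.eq_of_overlap i j h1 h2 (by linarith [h.pos j]) (by linarith [h.pos i])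
  · intro s hs
    obtain ⟨j, h1, h2⟩ := h.exists_mem_Ico (s := s) ⟨hp.trans hs.1, hs.2.trans_le hq⟩ ht
    have htj := le_antisymm (hcut j (hs.1.trans_lt h1.2) (h1.1.trans_lt hs.2) h2.2) h2.1
    exact ⟨j, by simpa using htj, h1⟩

theorem sum_bottom (h : IsSquareTiling M N x y a) (hM : 0 ≤ M) (hN : 0 < N) :
    ∑ j, (if y j = 0 then a j else 0) = M := by
  have := h.sum_overlap_eq le_rfl hM le_rfl ⟨le_rfl, hN⟩ fun j _ _ _ => h.bot_nonneg j
  rw [sub_zero] at this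
  rw [← this]
  refine Finset.sum_congr rfl fun j _ => ?_
  rw [min_eq_right (h.right_le j), max_eq_right (h.left_nonneg j), add_sub_cancel_left,
    max_eq_left (h.pos j).le]
  simp only [eq_comm]

theorem sum_overlap_above (h : IsSquareTiling M N x y a) (i : Fin n) (hi : y i + a i ≠ N) :
    ∑ j, (if y i + a i = y j then max (min (x i + a i) (x j + a j) - max (x i) (x j)) 0 else 0)
      = a i := by
  have hpos := h.pos i
  rw [h.sum_overlap_eq (h.left_nonneg i) (by linarith) (h.right_le i)
    ⟨by linarith [h.bot_nonneg i], lt_of_le_of_ne (h.top_le i) hi⟩]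
  · ring
  · intro j h1 h2 h3
    by_contra! h4
    have := h.eq_of_overlap i j h1 h2 (by linarith) h4
    subst this
    exact lt_irrefl _ h3

theorem sum_overlap_below (h : IsSquareTiling M N x y a) (j : Fin n) (hj : y j ≠ 0) :
    ∑ i, (if y i + a i = y j then max (min (x i + a i) (x j + a j) - max (x i) (x j)) 0 else 0)
      = a j := by
  refine Eq.trans ?_ (h.reflect.sum_overlap_above j (by simpa using hj))
  refine Finset.sum_congr rfl fun i _ => ?_
  rw [min_comm, max_comm (x i)]
  exact if_congr ⟨fun h => by linarith, fun h => by linarith⟩ rfl rfl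

open Classical in
theorem sum_segmentMatrix_mul_side (h : IsSquareTiling M N x y a) (c : Quot (Touch x y a)) :
    ∑ j, (segmentMatrix N x y a c j : ℝ) * a j = 0 := by
  let w : Fin n → Fin n → ℝ := fun i j =>
    if y i + a i = y j then max (min (x i + a i) (x j + a j) - max (x i) (x j)) 0 else 0
  have h1 : ∀ j, (if lowerSegment x y a j = some c then 1 else 0) * a j
      = ∑ i, (if lowerSegment x y a j = some c then 1 else 0) * w i j := by
    intro j
    rw [← Finset.mul_sum]
    by_cases hj : y j = 0
    · simp [lowerSegment, hj]
    · rw [h.sum_overlap_below j hj]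
  have h2 : ∀ i, (if upperSegment N x y a i = some c then 1 else 0) * a i
      = ∑ j, (if upperSegment N x y a i = some c then 1 else 0) * w i j := by
    intro i
    rw [← Finset.mul_sum]
    by_cases hi : y i + a i = N
    · simp [upperSegment, hi]
    · rw [h.sum_overlap_above i hi]
  have h3 : ∀ i j, (if lowerSegment x y a j = some c then 1 else 0) * w i j
      = (if upperSegment N x y a i = some c then 1 else 0) * w i j := by
    intro i j
    by_cases hw : w i j = 0
    · simp [hw]
    have hy : y i + a i = y j := by
      by_contra hne
      simp [w, hne] at hw
    have hov : max (x i) (x j) < min (x i + a i) (x j + a j) := by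
      by_contra! hle
      exact hw (by simp [w, hle])
    rw [max_lt_iff, lt_min_iff, lt_min_iff] at hov
    have ht : Touch x y a (i, true) (j, false) := ⟨rfl, rfl, hy, hov.1.2, hov.2.1⟩
    have e1 : y j ≠ 0 := by linarith [h.pos i, h.bot_nonneg i]
    have e2 : y i + a i ≠ N := by linarith [h.pos j, h.top_le j]
    rw [lowerSegment, upperSegment, if_neg e1, if_neg e2, Quot.sound ht]
  simp only [segmentMatrix, Matrix.of_apply, Int.cast_sub, Int.cast_ite, Int.cast_one,
    Int.cast_zero, sub_mul, Finset.sum_sub_distrib, h1, h2]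
  rw [Finset.sum_comm]
  simp [h3]

end IsSquareTiling

open Classical in
/-- The total weight of the squares met by a vertical line through `(s, 0)`, just to the right of
`s`, below height `t`. -/
noncomputable def columnSum {n : ℕ} (x y a b : Fin n → ℝ) (s t : ℝ) : ℝ :=
  ∑ j, if y j + a j ≤ t ∧ s ∈ Set.Ico (x j) (x j + a j) then b j else 0

namespace IsSquareTiling

variable {M N : ℝ} {n : ℕ} {x y a b : Fin n → ℝ}

/-- If the weights balance along every vertical segment, the column sum does not change along a
horizontal segment that no vertical segment crosses. -/
theorem columnSum_eq (h : IsSquareTiling M N x y a)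
    (hb : ∀ c, ∑ j, (segmentMatrix M y x a c j : ℝ) * b j = 0) {p s t : ℝ} (hp : 0 ≤ p)
    (hps : p ≤ s) (hs : s < M)
    (hcut : ∀ k, (x k ∈ Set.Ioc p s ∨ x k + a k ∈ Set.Ioc p s) → y k < t → y k + a k ≤ t) :
    columnSum x y a b s t = columnSum x y a b p t := by
  classical
  let pos : Fin n × Bool → ℝ := fun z => if z.2 then x z.1 + a z.1 else x z.1
  let ψ : Fin n × Bool → ℝ := fun z =>
    if pos z ∈ Set.Ioc p s ∧ y z.1 + a z.1 ≤ t then 1 else 0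
  have hψ := sum_mul_side_eq_zero hb ψ (by
    rintro ⟨i, _⟩ ⟨j, _⟩ ⟨rfl, rfl, h1, h2, h3⟩
    simp only at h1 h2 h3
    simp only [ψ, pos, if_true, Bool.false_eq_true, if_false, h1]
    refine if_congr (and_congr_right fun hx => ⟨fun h4 => ?_, fun h4 => ?_⟩) rfl rfl
    · exact hcut j (Or.inl hx) (h3.trans_le h4)
    · exact hcut i (Or.inr (h1 ▸ hx)) (h2.trans_le h4))
  rw [← sub_eq_zero, ← hψ, columnSum, columnSum, ← Finset.sum_sub_distrib]
  refine Finset.sum_congr rfl fun j _ => ?_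
  have ha := h.pos j
  have h1 : (if x j = 0 then 0 else ψ (j, false)) = ψ (j, false) := by
    split_ifs with h0
    · simp [ψ, pos, h0, hp.not_gt]
    · rfl
  have h2 : (if x j + a j = M then 0 else ψ (j, true)) = ψ (j, true) := by
    split_ifs with h0
    · simp [ψ, pos, h0, hs.not_ge]
    · rfl
  rw [h1, h2]
  simp only [ψ, pos, Set.mem_Ico, Set.mem_Ioc, if_true, Bool.false_eq_true, if_false]
  by_cases ht : y j + a j ≤ t
  · simp only [ht, and_true, true_and]
    by_cases c1 : x j ≤ p <;> by_cases c2 : x j ≤ s <;> by_cases c3 : x j + a j ≤ p <;>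
      by_cases c4 : x j + a j ≤ s <;>
      first
        | (exfalso; linarith)
        | simp [c1, c2, c3, c4, not_le.1, not_lt.2]
  · simp [ht]

theorem columnSum_eq_of_side (h : IsSquareTiling M N x y a)
    (hb : ∀ c, ∑ j, (segmentMatrix M y x a c j : ℝ) * b j = 0) {i : Fin n} {s t : ℝ}
    (hs : s ∈ Set.Ico (x i) (x i + a i)) (ht : t = y i ∨ t = y i + a i) :
    columnSum x y a b s t = columnSum x y a b (x i) t := by
  refine h.columnSum_eq hb (h.left_nonneg i) hs.1 (hs.2.trans_le (h.right_le i)) ?_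
  intro k hk hyt
  by_contra! hlt
  have hi := h.pos i
  have hk' := h.pos k
  have := h.eq_of_overlap i k
    (by rcases hk with hk | hk <;> linarith [hk.1])
    (by rcases hk with hk | hk <;> linarith [hk.2, hs.2])
    (by rcases ht with rfl | rfl <;> linarith)
    (by rcases ht with rfl | rfl <;> linarith)
  subst this
  rcases ht with rfl | rfl <;> linarith

theorem columnSum_top_sub_bot (h : IsSquareTiling M N x y a) (i : Fin n) :
    columnSum x y a b (x i) (y i + a i) - columnSum x y a b (x i) (y i) = b i := by
  classical
  have hi := h.pos i
  rw [columnSum, columnSum, ← Finset.sum_sub_distrib, Finset.sum_eq_single i]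
  · simp [hi]
  · intro j _ hj
    rw [sub_eq_zero]
    refine if_congr (and_congr_left fun hx => ⟨fun h1 => ?_, fun h1 => by linarith⟩) rfl rfl
    by_contra! h2
    exact hj (h.eq_of_overlap j i (by linarith [hx.1]) hx.2 (by linarith [h.pos j]) h2)
  · simp

theorem columnSum_zero (h : IsSquareTiling M N x y a) (s : ℝ) : columnSum x y a b s 0 = 0 := by
  refine Finset.sum_eq_zero fun j _ => if_neg fun hj => ?_
  linarith [h.pos j, h.bot_nonneg j, hj.1]

/-- A weight balanced along all interior segments whose sum along the bottom side of the rectangle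
is zero vanishes. -/
theorem eq_zero_of_balanced (h : IsSquareTiling M N x y a)
    (hA : ∀ c, ∑ j, (segmentMatrix N x y a c j : ℝ) * b j = 0)
    (hB : ∀ c, ∑ j, (segmentMatrix M y x a c j : ℝ) * b j = 0)
    (h0 : ∑ j, (if y j = 0 then b j else 0) = 0) : b = 0 := by
  let φ : Fin n × Bool → ℝ := fun z =>
    columnSum x y a b (x z.1) (if z.2 then y z.1 + a z.1 else y z.1)
  let V := columnSum x y a b 0 N
  have hφ := sum_mul_side_eq_zero hA φ (by
    rintro ⟨i, _⟩ ⟨j, _⟩ ⟨rfl, rfl, h1, h2, h3⟩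
    simp only at h1 h2 h3
    simp only [φ, if_true, Bool.false_eq_true, if_false]
    have hi := h.pos i
    have hj := h.pos j
    rw [← h.columnSum_eq_of_side hB (i := i) (s := max (x i) (x j))
        ⟨le_max_left _ _, max_lt (by linarith) h3⟩ (Or.inr rfl),
      ← h.columnSum_eq_of_side hB (i := j) (s := max (x i) (x j))
        ⟨le_max_right _ _, max_lt h2 (by linarith)⟩ (Or.inl rfl), h1])
  have h1 := sum_mul_side_eq_zero hA (fun _ => 1) fun _ _ _ => rfl
  have hsq : ∑ j, b j * b j = 0 := by
    have hterm : ∀ j, b j * b j = - (b j * ((if y j = 0 then 0 else φ (j, false))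
        - (if y j + a j = N then 0 else φ (j, true))))
        + V * (b j * ((if y j = 0 then 0 else 1) - (if y j + a j = N then 0 else 1)))
        + V * (if y j = 0 then b j else 0) := by
      intro j
      have e : b j * b j = b j * (φ (j, true) - φ (j, false)) := by
        rw [← h.columnSum_top_sub_bot (b := b) j]
        simp [φ]
      have e0 : y j = 0 → φ (j, false) = 0 := fun hy => by simp [φ, hy, h.columnSum_zero]
      have e1 : y j + a j = N → φ (j, true) = V := fun hy => by
        simp only [φ, if_true, hy]
        refine h.columnSum_eq hB le_rfl (h.left_nonneg j) ?_ fun k _ _ => h.top_le k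
        linarith [h.pos j, h.right_le j]
      rw [e]
      by_cases c0 : y j = 0 <;> by_cases c1 : y j + a j = N
      · rw [e0 c0, e1 c1]; simp only [if_pos c0, if_pos c1]; ring
      · rw [e0 c0]; simp only [if_pos c0, if_neg c1]; ring
      · rw [e1 c1]; simp only [if_pos c1, if_neg c0]; ring
      · simp only [if_neg c0, if_neg c1]; ring
    simp only [hterm, Finset.sum_add_distrib, Finset.sum_neg_distrib, ← Finset.mul_sum, hφ, h1, h0]
    simp
  funext j
  exact mul_self_eq_zero.1
    ((Finset.sum_eq_zero_iff_of_nonneg fun j _ => mul_self_nonneg (b j)).1 hsq j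
      (Finset.mem_univ j))

end IsSquareTiling

open Classical in
/-- A difference of two 0-1-matrices, each with at most one nonzero entry of each class in every
column, is a double incidence matrix. -/
theorem IsDoubleIncidence.of_ite {ι κ : Type*} {cl : ι → Bool} {C : Matrix ι κ ℤ}
    {P Q : ι → κ → Prop}
    (hC : ∀ i j, C i j = (if P i j then 1 else 0) - (if Q i j then 1 else 0))
    (hP : ∀ i i' j, cl i = cl i' → P i j → P i' j → i = i')
    (hQ : ∀ i i' j, cl i = cl i' → Q i j → Q i' j → i = i') : IsDoubleIncidence cl C := by
  have key : ∀ R : ι → κ → Prop, (∀ i i' j, cl i = cl i' → R i j → R i' j → i = i') →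
      ∀ (S : Finset ι) (b : Bool), (∀ i ∈ S, cl i = b) → ∀ j,
        0 ≤ (∑ i ∈ S, if R i j then 1 else 0 : ℤ) ∧ (∑ i ∈ S, if R i j then 1 else 0 : ℤ) ≤ 1 := by
    intro R hR S b hS j
    have hcard : (S.filter fun i => R i j).card ≤ 1 := by
      refine Finset.card_le_one.2 fun i hi i' hi' => ?_
      rw [Finset.mem_filter] at hi hi'
      exact hR i i' j ((hS i hi.1).trans (hS i' hi'.1).symm) hi.2 hi'.2
    rw [Finset.sum_boole]
    exact ⟨by positivity, by exact_mod_cast hcard⟩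
  intro S b hS j
  simp only [hC, Finset.sum_sub_distrib]
  have h1 := key P hP S b hS j
  have h2 := key Q hQ S b hS j
  rw [abs_le]
  constructor <;> linarith

open Classical in
/-- The incidence matrix of a tiling of `[0, M] × [0, N]`: one row for the bottom side of the
rectangle and one for every interior segment of either direction. -/
noncomputable def tilingMatrix (M N : ℝ) {n : ℕ} (x y a : Fin n → ℝ) :
    Matrix (Option (Quot (Touch x y a)) ⊕ Quot (Touch y x a)) (Fin n) ℤ
  | .inl none, j => if y j = 0 then 1 else 0
  | .inl (some c), j => segmentMatrix N x y a c j
  | .inr c, j => segmentMatrix M y x a c j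

theorem isDoubleIncidence_submatrix_tilingMatrix (M N : ℝ) {n : ℕ} (x y a : Fin n → ℝ) {κ : Type*}
    {f : κ → Option (Quot (Touch x y a)) ⊕ Quot (Touch y x a)} (hf : f.Injective) :
    IsDoubleIncidence (fun i => (f i).isLeft) ((tilingMatrix M N x y a).submatrix f id) := by
  classical
  refine IsDoubleIncidence.of_ite
    (P := fun i j => (f i).elim (fun c => lowerSegment x y a j = c)
      (fun c => lowerSegment y x a j = some c))
    (Q := fun i j => (f i).elim (fun c => c ≠ none ∧ upperSegment N x y a j = c)
      (fun c => upperSegment M y x a j = some c)) ?_ ?_ ?_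
  · intro i j
    rw [Matrix.submatrix_apply]
    rcases f i with (_ | c) | c
    · by_cases h0 : y j = 0 <;> simp [tilingMatrix, lowerSegment, h0]
    · simp [tilingMatrix, segmentMatrix]
      congr
    · simp [tilingMatrix, segmentMatrix]
      congr
  all_goals
    intro i i' j hcl h1 h2
    refine hf ?_
    revert hcl h1 h2
    rcases f i with c | c <;> rcases f i' with c' | c' <;> simp +contextual

/-- The width of a prime squaring divides a nonzero determinant of a square submatrix of its
incidence matrix, hence is at most exponential in the number of squares. -/
theorem IsSquareTiling.width_le_pow {τ : ℝ} (hτ1 : 1 ≤ τ) (hτ : τ ^ 2 + τ + 1 ≤ τ ^ 3) {M N n : ℕ}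
    (hN : 0 < N) {x y : Fin n → ℝ} {a : Fin n → ℕ}
    (h : IsSquareTiling M N x y fun i => (a i : ℝ)) (ha : Finset.univ.gcd a = 1) :
    (M : ℝ) ≤ τ ^ n := by
  classical
  set F := tilingMatrix M N x y fun i => (a i : ℝ) with hF
  obtain ⟨f, hf⟩ := Matrix.exists_det_submatrix_ne_zero (F.map (Int.cast : ℤ → ℝ)) (by
    intro b hb
    refine h.eq_zero_of_balanced (fun c => ?_) (fun c => ?_) ?_
    · simpa [F, Matrix.mulVec, dotProduct, tilingMatrix] using congrFun hb (.inl (some c))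
    · simpa [F, Matrix.mulVec, dotProduct, tilingMatrix] using congrFun hb (.inr c)
    · simpa [F, Matrix.mulVec, dotProduct, tilingMatrix] using congrFun hb (.inl none))
  set C := F.submatrix f id with hC
  have hdet : C.det ≠ 0 := by
    intro h0
    refine hf ?_
    rw [Matrix.submatrix_map, ← hC]
    have := Int.cast_det (R := ℝ) C
    rw [h0, Int.cast_zero] at this
    exact this.symm
  have hinj : f.Injective := by
    intro i i' hii
    by_contra hne
    exact hdet (Matrix.det_zero_of_row_eq hne (by ext j; simp [C, hii]))
  have hbound := IsDoubleIncidence.abs_det_le hτ1 hτ n _ C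
    (isDoubleIncidence_submatrix_tilingMatrix M N x y _ hinj)
  have hmul : C.mulVec (fun j => (a j : ℤ)) =
      (M : ℤ) • fun i => if f i = .inl none then (1 : ℤ) else 0 := by
    ext i
    have hcast : ((C.mulVec (fun j => (a j : ℤ)) i : ℤ) : ℝ) = ∑ j, (F (f i) j : ℝ) * a j := by
      simp [Matrix.mulVec, dotProduct, C]
    rw [← Int.cast_inj (α := ℝ), hcast]
    rcases hfi : f i with (_ | c) | c
    · simpa [F, tilingMatrix, hfi] using h.sum_bottom (by positivity) (by positivity)
    · simpa [F, tilingMatrix, hfi] using h.sum_segmentMatrix_mul_side c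
    · simpa [F, tilingMatrix, hfi] using h.swap.sum_segmentMatrix_mul_side c
  have hdvd : ∀ j, (M : ℤ) ∣ C.det * a j := by
    intro j
    have := congrArg (fun v => C.adjugate.mulVec v j) hmul
    simp only [Matrix.mulVec_mulVec, Matrix.adjugate_mul, Matrix.mulVec_smul, Matrix.smul_mulVec,
      Matrix.one_mulVec, Pi.smul_apply, smul_eq_mul] at this
    exact ⟨_, this⟩
  have hM : M ∣ C.det.natAbs := by
    have h1 : M ∣ Finset.univ.gcd fun j => C.det.natAbs * a j :=
      Finset.dvd_gcd fun j _ => by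
        simpa [Int.natAbs_mul] using Int.natAbs_dvd_natAbs.2 (hdvd j)
    rwa [Finset.gcd_mul_left, ha, normalize_eq, mul_one] at h1
  calc (M : ℝ) ≤ C.det.natAbs := by
        exact_mod_cast Nat.le_of_dvd (Int.natAbs_pos.2 hdet) hM
    _ = |(C.det : ℝ)| := by rw [Nat.cast_natAbs, Int.cast_abs]
    _ ≤ τ ^ n := hbound

theorem interior_sqTile (x y : ℝ) (a : ℕ) :
    interior (sqTile x y a) = Set.Ioo x (x + a) ×ˢ Set.Ioo y (y + a) := by
  rw [sqTile, interior_prod_eq, interior_Icc, interior_Icc]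

theorem isSquareTiling_of_sqTile {M N : ℝ} {n : ℕ} {x y : Fin n → ℝ} {a : Fin n → ℕ}
    (ha : ∀ i, 0 < a i)
    (hdisj : Pairwise fun i j =>
      Disjoint (interior (sqTile (x i) (y i) (a i))) (interior (sqTile (x j) (y j) (a j))))
    (hcover : (⋃ i, sqTile (x i) (y i) (a i)) = Set.Icc 0 M ×ˢ Set.Icc 0 N) :
    IsSquareTiling M N x y fun i => (a i : ℝ) := by
  have hsub : ∀ i, sqTile (x i) (y i) (a i) ⊆ Set.Icc 0 M ×ˢ Set.Icc 0 N := fun i =>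
    hcover ▸ Set.subset_iUnion (fun i => sqTile (x i) (y i) (a i)) i
  have hmin : ∀ i, (x i, y i) ∈ Set.Icc 0 M ×ˢ Set.Icc 0 N := fun i =>
    hsub i (by simp [sqTile])
  have hmax : ∀ i, (x i + a i, y i + a i) ∈ Set.Icc 0 M ×ˢ Set.Icc 0 N := fun i =>
    hsub i (by simp [sqTile])
  refine ⟨fun i => by exact_mod_cast ha i, fun i => (hmin i).1.1, fun i => (hmax i).1.2,
    fun i => (hmin i).2.1, fun i => (hmax i).2.2, ?_, ?_⟩
  · intro i j h1 h2 h3 h4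
    by_contra hij
    have hi : (0 : ℝ) < a i := by exact_mod_cast ha i
    have hj : (0 : ℝ) < a j := by exact_mod_cast ha j
    obtain ⟨s, hs, hs'⟩ := exists_between (show max (x i) (x j) < min (x i + a i) (x j + a j) from
      max_lt (lt_min (by linarith) h1) (lt_min h2 (by linarith)))
    obtain ⟨t, ht, ht'⟩ := exists_between (show max (y i) (y j) < min (y i + a i) (y j + a j) from
      max_lt (lt_min (by linarith) h3) (lt_min h4 (by linarith)))
    rw [max_lt_iff] at hs ht
    rw [lt_min_iff] at hs' ht'
    refine Set.disjoint_left.1 (hdisj hij) (show (s, t) ∈ _ from ?_) ?_ <;> rw [interior_sqTile]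
    · exact ⟨⟨hs.1, hs'.1⟩, ht.1, ht'.1⟩
    · exact ⟨⟨hs.2, hs'.2⟩, ht.2, ht'.2⟩
  · intro s t h1 h2 h3 h4
    have hst : (s, t) ∈ ⋃ i, sqTile (x i) (y i) (a i) := hcover ▸ ⟨⟨h1, h2⟩, h3, h4⟩
    obtain ⟨i, hi⟩ := Set.mem_iUnion.1 hst
    exact ⟨i, hi.1.1, hi.1.2, hi.2.1, hi.2.2⟩

/-- **Size of a prime squaring.**
If `max M N ≥ τ ^ k` (where `τ > 1` is the real root of `x³ = x² + 3`), then any prime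
squaring of the rectangle `R = [0,M] × [0,N]` — a dissection of `R` into `n`
axis-parallel squares with positive integer side lengths whose gcd is `1` — consists
of at least `k` tiles: `n ≥ k`. -/
theorem size_of_prime_squaring (τ : ℝ) (hτ1 : 1 < τ) (hτ : τ ^ 3 = τ ^ 2 + 3)
    (M N : ℕ) (hM : 0 < M) (hN : 0 < N) (k : ℕ)
    (hk : (max M N : ℝ) ≥ τ ^ k) (n : ℕ)
    (x y : Fin n → ℝ) (a : Fin n → ℕ) (ha : ∀ i, 0 < a i)
    (hsub : ∀ i, sqTile (x i) (y i) (a i) ⊆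
      Set.Icc (0 : ℝ) M ×ˢ Set.Icc (0 : ℝ) N)
    (hdisj : Pairwise fun i j =>
      Disjoint (interior (sqTile (x i) (y i) (a i)))
        (interior (sqTile (x j) (y j) (a j))))
    (hcover : (⋃ i, sqTile (x i) (y i) (a i)) =
      Set.Icc (0 : ℝ) M ×ˢ Set.Icc (0 : ℝ) N)
    (hprime : Finset.univ.gcd a = 1) :
    n ≥ k := by
  have h := isSquareTiling_of_sqTile ha hdisj hcover
  have hτ2 : τ ≤ 2 := by
    by_contra! h2
    nlinarith [mul_pos (sub_pos.2 h2) (sub_pos.2 hτ1)]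
  have hτ3 : τ ^ 2 + τ + 1 ≤ τ ^ 3 := by linarith
  have hle : (max M N : ℝ) ≤ τ ^ n :=
    max_le (h.width_le_pow hτ1.le hτ3 hN hprime) (h.swap.width_le_pow hτ1.le hτ3 hM hprime)
  exact (pow_le_pow_iff_right₀ hτ1).1 (hk.trans hle)
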